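/- Let 0 < δ ≤ 1. There is a constant C(δ) such that for every k ∈ ℤ² with k ≠ 0, Σ_{h ∈ ℤ², h ≠ 0, h ≠ k} α_{k,h}² / (‖h‖²·‖k−h‖²) ≤ C(δ)·‖k‖². -/

import Mathlib

/-- The Euclidean norm of a lattice point `k ∈ ℤ²`. -/
noncomputable def znorm (k : ℤ × ℤ) : ℝ := Real.sqrt ((k.1 : ℝ) ^ 2 + (k.2 : ℝ) ^ 2)

/-- `h^⊥ · k` where `h^⊥ = (−h₂, h₁)` and `·` is the standard dot product. -/
def perpDot (h k : ℤ × ℤ) : ℝ := ((-h.2 * k.1 + h.1 * k.2 : ℤ) : ℝ)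

/-- The interaction coefficient
`α_{k,h} = (1/2)·((h^⊥·k)/‖k‖)·(‖k−h‖^{−δ}‖h‖ − ‖h‖^{−δ}‖k−h‖)`
of the modified SQG nonlinearity. -/
noncomputable def alphaCoef (δ : ℝ) (k h : ℤ × ℤ) : ℝ :=
  (1 / 2) * (perpDot h k / znorm k) *
    (znorm (k - h) ^ (-δ) * znorm h - znorm h ^ (-δ) * znorm (k - h))

theorem znorm_nonneg (h : ℤ × ℤ) : 0 ≤ znorm h := Real.sqrt_nonneg _

theorem znorm_sq (h : ℤ × ℤ) : znorm h ^ 2 = (h.1 : ℝ) ^ 2 + (h.2 : ℝ) ^ 2 :=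
  Real.sq_sqrt (by positivity)

theorem znorm_eq_norm (h : ℤ × ℤ) : znorm h = ‖(h.1 : ℂ) + (h.2 : ℂ) * Complex.I‖ := by
  have := Complex.norm_add_mul_I (h.1 : ℝ) (h.2 : ℝ)
  push_cast at this
  rw [this, znorm]

theorem norm_le_znorm (h : ℤ × ℤ) : ‖h‖ ≤ znorm h := by
  rw [Prod.norm_def, Int.norm_eq_abs, Int.norm_eq_abs]
  exact max_le (Real.abs_le_sqrt (by nlinarith [sq_nonneg (h.2 : ℝ)]))
    (Real.abs_le_sqrt (by nlinarith [sq_nonneg (h.1 : ℝ)]))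

theorem znorm_pos {h : ℤ × ℤ} (hh : h ≠ 0) : 0 < znorm h :=
  (norm_pos_iff.2 hh).trans_le (norm_le_znorm h)

theorem znorm_sub_znorm_sub_le (k h : ℤ × ℤ) : znorm h - znorm (k - h) ≤ znorm k := by
  simp only [znorm_eq_norm]
  rw [sub_le_iff_le_add, ← norm_neg (((k - h).1 : ℂ) + _)]
  refine (congrArg norm ?_).trans_le (norm_add_le _ _)
  push_cast [Prod.fst_sub, Prod.snd_sub]
  ring

theorem perpDot_sub_self (k h : ℤ × ℤ) : perpDot (k - h) k = -perpDot h k := by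
  simp only [perpDot, Prod.fst_sub, Prod.snd_sub]
  push_cast
  ring

/-- The Cauchy–Schwarz inequality for `h^⊥ · k`. -/
theorem perpDot_sq_le (h k : ℤ × ℤ) : perpDot h k ^ 2 ≤ znorm h ^ 2 * znorm k ^ 2 := by
  rw [znorm_sq, znorm_sq, perpDot]
  push_cast
  nlinarith [sq_nonneg ((h.1 : ℝ) * k.1 + h.2 * k.2)]

theorem alphaCoef_sub_self (δ : ℝ) (k h : ℤ × ℤ) : alphaCoef δ k (k - h) = alphaCoef δ k h := by
  simp only [alphaCoef, perpDot_sub_self, sub_sub_cancel]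
  ring

theorem summable_znorm_rpow {s : ℝ} (hs : 2 < s) :
    Summable fun h : ℤ × ℤ => znorm h ^ (-s) := by
  have hsum : Summable fun h : ℤ × ℤ => ‖h‖ ^ (-s) := by
    refine ((finTwoArrowEquiv ℤ).symm.summable_iff.2
      (EisensteinSeries.summable_one_div_norm_rpow hs)).congr fun h => ?_
    simp [EisensteinSeries.norm_eq_max_natAbs, Prod.norm_def, Int.norm_eq_abs]
  refine hsum.of_nonneg_of_le (fun h => Real.rpow_nonneg (znorm_nonneg h) _) fun h => ?_
  rcases eq_or_ne h 0 with rfl | hh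
  · simp [znorm]
  · exact Real.rpow_le_rpow_of_nonpos (norm_pos_iff.2 hh) (norm_le_znorm h) (by linarith)

/-- The cancellation in the interaction coefficient. -/
theorem rpow_neg_mul_sub_bounds {δ a b : ℝ} (hδ : 0 < δ) (hδ1 : δ ≤ 1) (hb : 0 < b)
    (hab : b ≤ a) :
    0 ≤ b ^ (-δ) * a - a ^ (-δ) * b ∧
      b ^ (-δ) * a - a ^ (-δ) * b ≤ 2 * b ^ (-δ) * (a - b) := by
  have ha : 0 < a := hb.trans_le hab
  have hq : 0 < b ^ (-δ) := Real.rpow_pos_of_pos hb _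
  have hpq : a ^ (-δ) ≤ b ^ (-δ) := Real.rpow_le_rpow_of_nonpos hb hab (by linarith)
  have hmono : b ^ (-δ) * b ≤ a ^ (-δ) * a := by
    rw [← Real.rpow_add_one hb.ne', ← Real.rpow_add_one ha.ne']
    exact Real.rpow_le_rpow hb.le hab (by linarith)
  refine ⟨by nlinarith, le_of_mul_le_mul_right ?_ ha⟩
  nlinarith [mul_le_mul_of_nonneg_left hmono hb.le, mul_nonneg hq.le (sq_nonneg (a - b))]

theorem alphaCoef_sq_div_le_of_le {δ : ℝ} (hδ : 0 < δ) (hδ1 : δ ≤ 1) {k h : ℤ × ℤ} (hk : k ≠ 0)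
    (hkh : h ≠ k) (hle : znorm (k - h) ≤ znorm h) :
    alphaCoef δ k h ^ 2 / (znorm h ^ 2 * znorm (k - h) ^ 2)
      ≤ znorm k ^ 2 * znorm (k - h) ^ (-(2 + 2 * δ)) := by
  have hK := znorm_pos hk
  have hb := znorm_pos (sub_ne_zero.2 hkh.symm)
  have hD : perpDot h k ^ 2 ≤ znorm (k - h) ^ 2 * znorm k ^ 2 := by
    simpa [perpDot_sub_self] using perpDot_sq_le (k - h) k
  have htri := znorm_sub_znorm_sub_le k h
  obtain ⟨h0, h1⟩ := rpow_neg_mul_sub_bounds hδ hδ1 hb hle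
  have hpow : znorm (k - h) ^ (-(2 + 2 * δ)) = (znorm (k - h) ^ (-δ)) ^ 2 / znorm (k - h) ^ 2 := by
    rw [← Real.rpow_natCast (znorm (k - h) ^ (-δ)), ← Real.rpow_mul hb.le,
      ← Real.rpow_natCast (znorm (k - h)) 2, ← Real.rpow_sub hb]
    congr 1
    push_cast
    ring
  rw [hpow, alphaCoef]
  have hq : 0 < znorm (k - h) ^ (-δ) := Real.rpow_pos_of_pos hb _
  generalize znorm (k - h) ^ (-δ) * znorm h - znorm h ^ (-δ) * znorm (k - h) = X at *
  generalize znorm (k - h) ^ (-δ) = q at *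
  generalize perpDot h k = D at *
  generalize znorm h = a at *
  generalize znorm (k - h) = b at *
  generalize znorm k = K at *
  have hX : X ^ 2 ≤ (2 * q * K) ^ 2 := by
    gcongr
    exact h1.trans (by gcongr)
  have hDK : (D / K) ^ 2 ≤ b ^ 2 := by
    rw [div_pow, div_le_iff₀ (by positivity)]
    exact hD
  calc (1 / 2 * (D / K) * X) ^ 2 / (a ^ 2 * b ^ 2)
      = 1 / 4 * ((D / K) ^ 2 * X ^ 2) / (a ^ 2 * b ^ 2) := by ring
    _ ≤ 1 / 4 * (b ^ 2 * (2 * q * K) ^ 2) / (b ^ 2 * b ^ 2) := by gcongr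
    _ = K ^ 2 * (q ^ 2 / b ^ 2) := by field_simp; ring

theorem alphaCoef_sq_div_le {δ : ℝ} (hδ : 0 < δ) (hδ1 : δ ≤ 1) {k h : ℤ × ℤ} (hk : k ≠ 0)
    (hh : h ≠ 0) (hkh : h ≠ k) :
    alphaCoef δ k h ^ 2 / (znorm h ^ 2 * znorm (k - h) ^ 2)
      ≤ znorm k ^ 2 * (znorm h ^ (-(2 + 2 * δ)) + znorm (k - h) ^ (-(2 + 2 * δ))) := by
  rw [mul_add]
  have ha : 0 ≤ znorm k ^ 2 * znorm h ^ (-(2 + 2 * δ)) :=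
    mul_nonneg (sq_nonneg _) (Real.rpow_nonneg (znorm_nonneg _) _)
  have hb : 0 ≤ znorm k ^ 2 * znorm (k - h) ^ (-(2 + 2 * δ)) :=
    mul_nonneg (sq_nonneg _) (Real.rpow_nonneg (znorm_nonneg _) _)
  rcases le_total (znorm (k - h)) (znorm h) with hle | hle
  · linarith [alphaCoef_sq_div_le_of_le hδ hδ1 hk hkh hle]
  · have := alphaCoef_sq_div_le_of_le hδ hδ1 (h := k - h) hk (by simpa using hh)
      (by simpa using hle)
    rw [alphaCoef_sub_self, sub_sub_cancel, mul_comm (znorm (k - h) ^ 2)] at this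
    linarith

/-- The key frequency-by-frequency estimate in the proof of Proposition 4.1: for `0 < δ ≤ 1`
there is a constant `C(δ)` such that for every `k ≠ 0`,
`Σ_{h≠0, h≠k} α_{k,h}² / (‖h‖²·‖k−h‖²) ≤ C(δ)·‖k‖²` (the sum being finite). -/
theorem frequency_estimate (δ : ℝ) (hδ : 0 < δ) (hδ1 : δ ≤ 1) :
    ∃ C : ℝ, 0 < C ∧ ∀ k : ℤ × ℤ, k ≠ 0 →
      Summable (fun h : {h : ℤ × ℤ // h ≠ 0 ∧ h ≠ k} =>
        alphaCoef δ k (h : ℤ × ℤ) ^ 2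
          / (znorm (h : ℤ × ℤ) ^ 2 * znorm (k - (h : ℤ × ℤ)) ^ 2)) ∧
      (∑' h : {h : ℤ × ℤ // h ≠ 0 ∧ h ≠ k},
        alphaCoef δ k (h : ℤ × ℤ) ^ 2
          / (znorm (h : ℤ × ℤ) ^ 2 * znorm (k - (h : ℤ × ℤ)) ^ 2)) ≤ C * znorm k ^ 2 := by
  set f : ℤ × ℤ → ℝ := fun h => znorm h ^ (-(2 + 2 * δ))
  have hf0 (h : ℤ × ℤ) : 0 ≤ f h := Real.rpow_nonneg (znorm_nonneg h) _
  have hfs : Summable f := summable_znorm_rpow (by linarith)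
  have hS : 0 ≤ ∑' h, f h := tsum_nonneg hf0
  refine ⟨2 * (∑' h, f h) + 1, by positivity, fun k hk => ?_⟩
  have hfs' : Summable fun h => f (k - h) := (Equiv.subLeft k).summable_iff.2 hfs
  have htsum : ∑' h, f (k - h) = ∑' h, f h := (Equiv.subLeft k).tsum_eq f
  have hgs : Summable fun h => znorm k ^ 2 * (f h + f (k - h)) := (hfs.add hfs').mul_left _
  have hle (h : {h : ℤ × ℤ // h ≠ 0 ∧ h ≠ k}) :=
    alphaCoef_sq_div_le hδ hδ1 hk h.2.1 h.2.2
  have hsub := hgs.comp_injective (Subtype.val_injective (p := fun h => h ≠ 0 ∧ h ≠ k))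
  have hsum := hsub.of_nonneg_of_le (fun h => by positivity) hle
  refine ⟨hsum, (hsum.tsum_le_tsum hle hsub).trans ?_⟩
  calc _ ≤ ∑' h, znorm k ^ 2 * (f h + f (k - h)) :=
        hgs.tsum_subtype_le _ {h | h ≠ 0 ∧ h ≠ k}
          fun h => mul_nonneg (sq_nonneg _) (add_nonneg (hf0 _) (hf0 _))
    _ = 2 * (∑' h, f h) * znorm k ^ 2 := by
        rw [tsum_mul_left, hfs.tsum_add hfs', htsum]
        ring
    _ ≤ _ := by nlinarith [sq_nonneg (znorm k)]
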